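/- Let f : ℝ² → ℝ be a polynomial function with f(0,0) = 0, and let r > 0 be such that f(p) > 0 for every p in the closed ball of radius r centered at the origin with p ≠ (0,0), and the gradient ∇f(p) ≠ 0 for every such p. Then there exists ε₀ > 0 such that for every ε with 0 < ε < ε₀, the connected component D_ε containing the origin of the sublevel set {p ∈ ℝ² : f(p) ≤ ε} is homeomorphic to the closed unit disk {v ∈ ℝ² : ‖v‖ ≤ 1}, and the origin lies in the topological interior of D_ε. -/

import Mathlib

open Set Filter Topology Metric NNReal

section GlobalFlow

variable {E : Type*} [NormedAddCommGroup E] [NormedSpace ℝ E] {v : E → E} {K : ℝ≥0}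

/-- A bounded Lipschitz vector field has a global integral curve through every point. -/
theorem LipschitzWith.exists_forall_hasDerivAt [CompleteSpace E] (hv : LipschitzWith K v)
    {M : ℝ≥0} (hM : ∀ x, ‖v x‖ ≤ M) (x : E) :
    ∃ α : ℝ → E, α 0 = x ∧ ∀ t, HasDerivAt α (v (α t)) t := by
  have key (n : ℕ) : ∃ α : ℝ → E, α 0 = x ∧
      ∀ t ∈ Ioo (-((n : ℝ) + 1)) (n + 1), HasDerivAt α (v (α t)) t := by
    have hn : (0 : ℝ) < n + 1 := by positivity
    have h : IsPicardLindelof (fun _ : ℝ => v) (tmin := -((n : ℝ) + 1)) (tmax := n + 1)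
        ⟨0, by constructor <;> linarith⟩ x (M * (n + 1)) 0 M K :=
      ⟨fun _ _ => hv.lipschitzOnWith, fun _ _ => continuousOn_const, fun _ _ y _ => hM y, by simp⟩
    obtain ⟨α, h0, hα⟩ := h.exists_eq_forall_mem_Icc_hasDerivWithinAt₀
    exact ⟨α, h0, fun t ht => (hα t (Ioo_subset_Icc_self ht)).hasDerivAt (Icc_mem_nhds ht.1 ht.2)⟩
  choose a ha0 ha using key
  have huniq (m n : ℕ) (t : ℝ) (hm : |t| < m + 1) (hn : |t| < n + 1) : a m t = a n t := by
    obtain ⟨k, hk, hkm, hkn⟩ : ∃ k : ℝ, |t| < k ∧ k ≤ m + 1 ∧ k ≤ n + 1 :=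
      ⟨min (m + 1) (n + 1), lt_min hm hn, min_le_left _ _, min_le_right _ _⟩
    have h0 : (0 : ℝ) < k := (abs_nonneg t).trans_lt hk
    refine ODE_solution_unique_of_mem_Ioo (v := fun _ => v) (s := fun _ => univ) (t₀ := 0)
      (a := -k) (b := k) (fun _ _ => hv.lipschitzOnWith) ⟨by linarith, h0⟩
      (fun s hs => ⟨ha m s ⟨?_, ?_⟩, trivial⟩) (fun s hs => ⟨ha n s ⟨?_, ?_⟩, trivial⟩)
      (by rw [ha0, ha0]) (abs_lt.1 hk)
    all_goals linarith [hs.1, hs.2]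
  refine ⟨fun t => a ⌈|t|⌉₊ t, ha0 _, fun t => ?_⟩
  have hlt (s : ℝ) : |s| < (⌈|s|⌉₊ : ℝ) + 1 := (Nat.le_ceil _).trans_lt (lt_add_one _)
  refine (ha _ t (abs_lt.1 (hlt t))).congr_of_eventuallyEq ?_
  filter_upwards [continuous_abs.continuousAt.eventually_lt continuousAt_const (hlt t)] with s hs
  exact huniq _ _ s (hlt s) hs

/-- Integral curves of a Lipschitz vector field separate at most exponentially. -/
theorem LipschitzWith.dist_le_of_forall_hasDerivAt (hv : LipschitzWith K v) {α β : ℝ → E}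
    (hα : ∀ t, HasDerivAt α (v (α t)) t) (hβ : ∀ t, HasDerivAt β (v (β t)) t) (t : ℝ) :
    dist (α t) (β t) ≤ dist (α 0) (β 0) * Real.exp (K * |t|) := by
  have aux {w : E → E} (hw : LipschitzWith K w) {α β : ℝ → E}
      (hα : ∀ t, HasDerivAt α (w (α t)) t) (hβ : ∀ t, HasDerivAt β (w (β t)) t) (t : ℝ)
      (ht : 0 ≤ t) : dist (α t) (β t) ≤ dist (α 0) (β 0) * Real.exp (K * t) := by
    simpa using dist_le_of_trajectories_ODE (v := fun _ => w) (a := 0) (b := t) (fun _ => hw)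
      (HasDerivAt.continuousOn fun s _ => hα s) (fun s _ => (hα s).hasDerivWithinAt)
      (HasDerivAt.continuousOn fun s _ => hβ s) (fun s _ => (hβ s).hasDerivWithinAt) le_rfl
      t ⟨ht, le_rfl⟩
  rcases le_total 0 t with ht | ht
  · rw [abs_of_nonneg ht]
    exact aux hv hα hβ t ht
  · have hrev {γ : ℝ → E} (hγ : ∀ t, HasDerivAt γ (v (γ t)) t) (s : ℝ) :
        HasDerivAt (fun s => γ (-s)) (-v (γ (-s))) s := by
      simpa [Function.comp_def] using (hγ (-s)).scomp s (hasDerivAt_neg s)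
    have := aux (w := fun x => -v x) hv.neg (hrev hα) (hrev hβ) (-t) (by linarith)
    simpa [abs_of_nonpos ht] using this

/-- A compactly supported `C¹` vector field generates a global flow, which fixes its zeros. -/
theorem exists_flow_of_contDiff [CompleteSpace E] (hv : ContDiff ℝ 1 v) (hc : HasCompactSupport v) :
    ∃ φ : Flow ℝ E, (∀ x t, HasDerivAt (fun t => φ t x) (v (φ t x)) t) ∧
      ∀ x, v x = 0 → ∀ t, φ t x = x := by
  obtain ⟨K, hK⟩ := hv.lipschitzWith_of_hasCompactSupport hc one_ne_zero
  obtain ⟨M, hM⟩ := hc.exists_bound_of_continuous hv.continuous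
  choose α hα0 hα using fun x => hK.exists_forall_hasDerivAt
    (M := ⟨max M 0, le_max_right _ _⟩) (fun x => (hM x).trans (le_max_left _ _)) x
  have huniq {β γ : ℝ → E} (hβ : ∀ t, HasDerivAt β (v (β t)) t)
      (hγ : ∀ t, HasDerivAt γ (v (γ t)) t) (h0 : β 0 = γ 0) (t : ℝ) : β t = γ t := by
    simpa [h0] using hK.dist_le_of_forall_hasDerivAt hβ hγ t
  refine ⟨⟨fun t x => α x t, ?_, fun s t x => ?_, hα0⟩, hα, fun x hx t => ?_⟩
  · rw [continuous_iff_continuousAt]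
    rintro ⟨t, x⟩
    have hb : Tendsto (fun p : ℝ × E => dist p.2 x * Real.exp (K * |p.1|) +
        dist (α x p.1) (α x t)) (𝓝 (t, x)) (𝓝 0) := by
      have hcont : Continuous (α x) :=
        continuous_iff_continuousAt.2 fun t => (hα x t).continuousAt
      have : Continuous fun p : ℝ × E => dist p.2 x * Real.exp (K * |p.1|) +
        dist (α x p.1) (α x t) := by fun_prop
      simpa using this.tendsto (t, x)
    refine tendsto_iff_dist_tendsto_zero.2
      (squeeze_zero (fun _ => dist_nonneg) (fun p => ?_) hb)
    refine (dist_triangle _ (α x p.1) _).trans (add_le_add_left ?_ _)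
    simpa [hα0, Function.uncurry] using hK.dist_le_of_forall_hasDerivAt (hα p.2) (hα x) p.1
  · exact huniq (β := fun s => α x (s + t)) (γ := α (α x t))
      (fun s => (hα x (s + t)).comp_add_const s t) (hα _) (by simp [hα0]) s
  · exact huniq (γ := fun _ => x) (hα x) (fun t => by simpa [hx] using hasDerivAt_const t x)
      (hα0 x) t

end GlobalFlow

section Descent

variable {E : Type*} [NormedAddCommGroup E]

/-- The part of the sublevel set `{f ≤ ε}` in the closed ball of radius `r` around the origin. -/
def ballSublevel (f : E → ℝ) (r ε : ℝ) : Set E := {p | ‖p‖ ≤ r ∧ f p ≤ ε}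

/-- The part of the level set `{f = ε}` in the closed ball of radius `r` around the origin. -/
def ballLevel (f : E → ℝ) (r ε : ℝ) : Set E := {p | ‖p‖ ≤ r ∧ f p = ε}

/-- `f` has a strict minimum at the origin, among the points of norm at most `r`, with value `0`,
and its values on the sphere of radius `r` exceed `ε`. -/
structure IsWell (f : E → ℝ) (r ε : ℝ) : Prop where
  cont : Continuous f
  radius_pos : 0 < r
  height_pos : 0 < ε
  map_zero : f 0 = 0
  pos : ∀ p, ‖p‖ ≤ r → p ≠ 0 → 0 < f p
  lt_sphere : ∀ p, ‖p‖ = r → ε < f p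

/-- The flow `φ` decreases `f` at rate `d`, which is positive at every nonzero point of norm at most
`r`, and fixes the origin. -/
structure IsDescentFlow (f : E → ℝ) (r : ℝ) (φ : Flow ℝ E) (d : E → ℝ) : Prop where
  cont : Continuous d
  nonneg : ∀ p, 0 ≤ d p
  pos : ∀ p, ‖p‖ ≤ r → p ≠ 0 → 0 < d p
  hasDerivAt : ∀ p t, HasDerivAt (fun t => f (φ t p)) (-d (φ t p)) t
  map_zero : ∀ t, φ t 0 = 0

variable {f d : E → ℝ} {r ε : ℝ} {φ : Flow ℝ E}

theorem ballLevel_subset_ballSublevel : ballLevel f r ε ⊆ ballSublevel f r ε :=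
  fun _ hp => ⟨hp.1, hp.2.le⟩

namespace IsWell

variable (hf : IsWell f r ε)
include hf

theorem zero_mem : (0 : E) ∈ ballSublevel f r ε :=
  ⟨by simpa using hf.radius_pos.le, by simpa [hf.map_zero] using hf.height_pos.le⟩

theorem isCompact_ballSublevel [ProperSpace E] : IsCompact (ballSublevel f r ε) := by
  have : ballSublevel f r ε = closedBall 0 r ∩ f ⁻¹' Iic ε := by ext; simp [ballSublevel]
  rw [this]
  exact (isCompact_closedBall _ _).inter_right (isClosed_Iic.preimage hf.cont)

theorem isCompact_ballLevel [ProperSpace E] : IsCompact (ballLevel f r ε) := by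
  have : ballLevel f r ε = closedBall 0 r ∩ f ⁻¹' {ε} := by ext; simp [ballLevel]
  rw [this]
  exact (isCompact_closedBall _ _).inter_right (isClosed_singleton.preimage hf.cont)

theorem ne_zero_of_mem_ballLevel {p : E} (hp : p ∈ ballLevel f r ε) : p ≠ 0 := by
  rintro rfl
  exact hf.height_pos.ne (hf.map_zero ▸ hp.2)

theorem ballSublevel_mem_nhds_zero : ballSublevel f r ε ∈ 𝓝 (0 : E) := by
  filter_upwards [ball_mem_nhds (0 : E) hf.radius_pos,
    hf.cont.continuousAt.eventually_lt continuousAt_const (hf.map_zero ▸ hf.height_pos)]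
    with p hp hp'
  exact ⟨(mem_ball_zero_iff.1 hp).le, hp'.le⟩

/-- A curve that stays below height `ε` cannot leave the well. -/
theorem mem_of_isPreconnected {c : ℝ → E} (hc : Continuous c) {I : Set ℝ} (hI : IsPreconnected I)
    {a b : ℝ} (ha : a ∈ I) (hb : b ∈ I) (har : ‖c a‖ ≤ r) (h : ∀ t ∈ I, f (c t) ≤ ε) :
    c b ∈ ballSublevel f r ε := by
  refine ⟨?_, h b hb⟩
  by_contra! hbr
  obtain ⟨t, ht, htr⟩ := hI.intermediate_value ha hb (f := fun t => ‖c t‖) (by fun_prop)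
    ⟨har, hbr.le⟩
  exact (hf.lt_sphere _ htr).not_ge (h t ht)

theorem exists_pos_norm_lt [ProperSpace E] {ρ : ℝ} (hρ : 0 < ρ) :
    ∃ η > 0, ∀ p ∈ ballSublevel f r ε, f p < η → ‖p‖ < ρ := by
  have hC : IsCompact (ballSublevel f r ε ∩ {p | ρ ≤ ‖p‖}) :=
    hf.isCompact_ballSublevel.inter_right (isClosed_le continuous_const continuous_norm)
  rcases Set.eq_empty_or_nonempty (ballSublevel f r ε ∩ {p | ρ ≤ ‖p‖}) with he | hne
  · refine ⟨1, one_pos, fun p hp _ => ?_⟩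
    by_contra! h
    exact he.subset ⟨hp, h⟩
  · obtain ⟨q, hq, hmin⟩ := hC.exists_isMinOn hne hf.cont.continuousOn
    refine ⟨f q, hf.pos q hq.1.1 (norm_pos_iff.1 (hρ.trans_le hq.2)), fun p hp hpq => ?_⟩
    by_contra! h
    exact hpq.not_ge (hmin ⟨hp, h⟩)

end IsWell

namespace IsDescentFlow

variable (hφ : IsDescentFlow f r φ d)
include hφ

theorem antitone (p : E) : Antitone fun t => f (φ t p) :=
  antitone_of_deriv_nonpos (fun t => (hφ.hasDerivAt p t).differentiableAt) fun t => by
    rw [(hφ.hasDerivAt p t).deriv]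
    exact neg_nonpos.2 (hφ.nonneg _)

theorem ne_zero {p : E} (hp : p ≠ 0) (t : ℝ) : φ t p ≠ 0 := by
  intro h
  apply hp
  rw [← φ.map_zero_apply p, ← neg_add_cancel t, φ.map_add, h, hφ.map_zero]

theorem mul_le_sub {p : E} {c t : ℝ} (ht : 0 ≤ t) (h : ∀ s ∈ Icc 0 t, c ≤ d (φ s p)) :
    c * t ≤ f p - f (φ t p) := by
  have := (convex_Icc 0 t).image_sub_le_mul_sub_of_deriv_le (f := fun t => f (φ t p)) (C := -c)
    (HasDerivAt.continuousOn fun s _ => hφ.hasDerivAt p s)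
    (fun s _ => (hφ.hasDerivAt p s).differentiableAt.differentiableWithinAt)
    (fun s hs => by
      rw [(hφ.hasDerivAt p s).deriv]
      exact neg_le_neg (h s (interior_subset hs)))
    0 ⟨le_rfl, ht⟩ t ⟨ht, le_rfl⟩ ht
  simp only [φ.map_zero_apply] at this
  linarith

variable (hf : IsWell f r ε)
include hf

theorem map_mem {p : E} (hp : p ∈ ballSublevel f r ε) {t : ℝ} (ht : 0 ≤ t) :
    φ t p ∈ ballSublevel f r ε := by
  refine hf.mem_of_isPreconnected (c := fun t => φ t p) (by fun_prop) isPreconnected_Ici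
    (mem_Ici.2 le_rfl) (mem_Ici.2 ht) (by simpa using hp.1) fun s hs => ?_
  have := hφ.antitone p (mem_Ici.1 hs)
  simp only [φ.map_zero_apply] at this
  exact this.trans hp.2

theorem map_lt {p : E} (hp : p ∈ ballSublevel f r ε) (h0 : p ≠ 0) {t : ℝ} (ht : 0 < t) :
    f (φ t p) < f p := by
  have := strictAntiOn_of_deriv_neg (convex_Ici 0) (f := fun t => f (φ t p))
    (HasDerivAt.continuousOn fun s _ => hφ.hasDerivAt p s)
    (fun s hs => by
      rw [(hφ.hasDerivAt p s).deriv]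
      exact neg_lt_zero.2 (hφ.pos _ (hφ.map_mem hf hp (interior_subset hs)).1 (hφ.ne_zero h0 s)))
    (mem_Ici.2 le_rfl) (mem_Ici.2 ht.le) ht
  simpa using this

theorem eq_of_map_eq {x y : E} (hx : x ∈ ballLevel f r ε) (hy : y ∈ ballLevel f r ε) {s t : ℝ}
    (h : φ s x = φ t y) : s = t ∧ x = y := by
  have aux {x y : E} (hx : x ∈ ballLevel f r ε) (hy : y ∈ ballLevel f r ε) {s t : ℝ}
      (h : φ s x = φ t y) : t ≤ s := by
    by_contra! hst
    have hxy : φ (t - s) y = x := by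
      rw [sub_eq_neg_add, φ.map_add, ← h, ← φ.map_add, neg_add_cancel, φ.map_zero_apply]
    have := hφ.map_lt hf (ballLevel_subset_ballSublevel hy) (hf.ne_zero_of_mem_ballLevel hy)
      (sub_pos.2 hst)
    rw [hxy, hx.2, hy.2] at this
    exact this.false
  obtain rfl := le_antisymm (aux hy hx h.symm) (aux hx hy h)
  refine ⟨rfl, ?_⟩
  rw [← φ.map_zero_apply x, ← neg_add_cancel s, φ.map_add, h, ← φ.map_add, neg_add_cancel,
    φ.map_zero_apply]

variable [ProperSpace E]

theorem exists_pos_le {η : ℝ} (hη : 0 < η) :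
    ∃ c > 0, ∀ p ∈ ballSublevel f r ε, η ≤ f p → c ≤ d p := by
  have hC : IsCompact (ballSublevel f r ε ∩ {p | η ≤ f p}) :=
    hf.isCompact_ballSublevel.inter_right (isClosed_le continuous_const hf.cont)
  rcases Set.eq_empty_or_nonempty (ballSublevel f r ε ∩ {p | η ≤ f p}) with he | hne
  · exact ⟨1, one_pos, fun p hp h => (he.subset ⟨hp, h⟩).elim⟩
  · obtain ⟨q, hq, hmin⟩ := hC.exists_isMinOn hne hφ.cont.continuousOn
    refine ⟨d q, hφ.pos q hq.1.1 ?_, fun p hp h => hmin ⟨hp, h⟩⟩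
    rintro rfl
    exact (hq.2.trans_eq hf.map_zero).not_gt hη

theorem exists_forall_norm_lt {ρ : ℝ} (hρ : 0 < ρ) :
    ∃ T ≥ 0, ∀ t ≥ T, ∀ p ∈ ballSublevel f r ε, ‖φ t p‖ < ρ := by
  obtain ⟨η, hη, hηρ⟩ := hf.exists_pos_norm_lt hρ
  obtain ⟨c, hc, hcd⟩ := hφ.exists_pos_le hf hη
  have hT : 0 ≤ ε / c := div_nonneg hf.height_pos.le hc.le
  refine ⟨ε / c, hT, fun t ht p hp => ?_⟩
  have ht0 := hT.trans ht
  refine hηρ _ (hφ.map_mem hf hp ht0) ?_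
  by_contra! h
  have h1 := hφ.mul_le_sub ht0 fun s hs =>
    hcd _ (hφ.map_mem hf hp hs.1) (h.trans (hφ.antitone p hs.2))
  have h2 : ε ≤ c * t := by
    rw [mul_comm]
    exact (div_le_iff₀ hc).1 ht
  linarith [hp.2]

theorem exists_map_eq {p : E} (hp : p ∈ ballSublevel f r ε) (h0 : p ≠ 0) :
    ∃ t ≥ 0, ∃ x ∈ ballLevel f r ε, φ t x = p := by
  have hback (t : ℝ) : φ t (φ (-t) p) = p := by
    rw [← φ.map_add, add_neg_cancel, φ.map_zero_apply]
  have hmono : Monotone fun t => f (φ (-t) p) := fun s t hst => hφ.antitone p (neg_le_neg hst)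
  have hcont : Continuous fun t : ℝ => φ (-t) p := by fun_prop
  obtain ⟨t, ht, hε⟩ : ∃ t ≥ 0, f (φ (-t) p) = ε := by
    by_contra! hne
    have hlt : ∀ t ∈ Ici (0 : ℝ), f (φ (-t) p) ≤ ε := by
      intro t ht
      by_contra! h
      obtain ⟨s, hs, hsε⟩ := isPreconnected_Ici.intermediate_value (mem_Ici.2 le_rfl) ht
        (f := fun t => f (φ (-t) p)) (hf.cont.comp hcont).continuousOn
        ⟨by simpa using hp.2, h.le⟩
      exact hne s hs hsε
    have hmem (t : ℝ) (ht : 0 ≤ t) : φ (-t) p ∈ ballSublevel f r ε :=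
      hf.mem_of_isPreconnected hcont isPreconnected_Ici (mem_Ici.2 le_rfl) (mem_Ici.2 ht)
        (by simpa using hp.1) hlt
    obtain ⟨c, hc, hcd⟩ := hφ.exists_pos_le hf (hf.pos p hp.1 h0)
    have hT : 0 ≤ ε / c := div_nonneg hf.height_pos.le hc.le
    have h1 := hφ.mul_le_sub (p := φ (-(ε / c)) p) hT fun s hs => by
      have : φ s (φ (-(ε / c)) p) = φ (-(ε / c - s)) p := by
        rw [← φ.map_add]
        congr 1
        ring
      rw [this]
      refine hcd _ (hmem _ (sub_nonneg.2 hs.2)) ?_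
      simpa using hmono (sub_nonneg.2 hs.2)
    rw [hback, mul_div_cancel₀ _ hc.ne'] at h1
    linarith [(hmem _ hT).2, hf.pos p hp.1 h0]
  refine ⟨t, ht, φ (-t) p, ⟨?_, hε⟩, hback t⟩
  exact (hf.mem_of_isPreconnected hcont isPreconnected_Icc (a := 0) (b := t) ⟨le_rfl, ht⟩
    ⟨ht, le_rfl⟩ (by simpa using hp.1) fun s hs => (hmono hs.2).trans_eq hε).1

theorem isPreconnected_ballSublevel : IsPreconnected (ballSublevel f r ε) := by
  refine isPreconnected_of_forall 0 fun p hp =>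
    ⟨closure ((fun t => φ t p) '' Ici 0), ?_, ?_, subset_closure ⟨0, by simp⟩,
      (isPreconnected_Ici.image _ (by fun_prop)).closure⟩
  · refine closure_minimal ?_ hf.isCompact_ballSublevel.isClosed
    rintro _ ⟨t, ht, rfl⟩
    exact hφ.map_mem hf hp ht
  · refine Metric.mem_closure_iff.2 fun ρ hρ => ?_
    obtain ⟨T, hT, h⟩ := hφ.exists_forall_norm_lt hf hρ
    exact ⟨φ T p, ⟨T, hT, rfl⟩, by simpa using h T le_rfl p hp⟩

theorem connectedComponentIn_eq :
    connectedComponentIn {p | f p ≤ ε} 0 = ballSublevel f r ε := by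
  refine Subset.antisymm (fun p hp => ?_)
    ((hφ.isPreconnected_ballSublevel hf).subset_connectedComponentIn hf.zero_mem fun p hp => hp.2)
  have hsub := connectedComponentIn_subset {p | f p ≤ ε} (0 : E)
  refine ⟨?_, hsub hp⟩
  by_contra! h
  obtain ⟨q, hq, hqr⟩ := isPreconnected_connectedComponentIn.intermediate_value
    (mem_connectedComponentIn (F := {p | f p ≤ ε}) hf.zero_mem.2) hp continuous_norm.continuousOn
    ⟨by simpa using hf.radius_pos.le, h.le⟩
  exact (hf.lt_sphere q hqr).not_ge (hsub hq)

end IsDescentFlow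

end Descent

section Level

variable {E : Type*} [NormedAddCommGroup E]

/-- The flow `ψ` preserves `f`, and each of its orbits in the level set `{f = ε}` is
one-dimensional and contains a neighbourhood, in the level set, of each of its points. -/
structure IsLevelFlow (f : E → ℝ) (r ε : ℝ) (ψ : Flow ℝ E) : Prop where
  map_eq : ∀ t p, f (ψ t p) = f p
  image_mem_nhdsWithin : ∀ x ∈ ballLevel f r ε,
    (fun t => ψ t x) '' Ioo (-1) 1 ∈ 𝓝[ballLevel f r ε] x
  exists_map_ne : ∀ x ∈ ballLevel f r ε, ∃ t, ψ t x ≠ x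

namespace IsLevelFlow

variable {f d : E → ℝ} {r ε : ℝ} {φ ψ : Flow ℝ E} (hψ : IsLevelFlow f r ε ψ)
  (hf : IsWell f r ε)
include hψ hf

theorem map_mem {x : E} (hx : x ∈ ballLevel f r ε) (t : ℝ) : ψ t x ∈ ballLevel f r ε := by
  have h (s : ℝ) : f (ψ s x) = ε := (hψ.map_eq s x).trans hx.2
  exact ⟨(hf.mem_of_isPreconnected (c := fun t => ψ t x) (by fun_prop) isPreconnected_univ
    (mem_univ 0) (mem_univ t) (by simpa using hx.1) fun s _ => (h s).le).1, h t⟩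

theorem range_subset {x : E} (hx : x ∈ ballLevel f r ε) :
    range (fun t => ψ t x) ⊆ ballLevel f r ε :=
  range_subset_iff.2 (hψ.map_mem hf hx)

variable [ProperSpace E]

theorem isClosed_range {x : E} (hx : x ∈ ballLevel f r ε) : IsClosed (range fun t => ψ t x) := by
  refine isClosed_of_closure_subset fun y hy => ?_
  have hsub := hψ.range_subset hf hx
  have hyL := closure_minimal hsub hf.isCompact_ballLevel.isClosed hy
  have := mem_closure_iff_nhdsWithin_neBot.1 hy
  obtain ⟨_, ⟨t, -, rfl⟩, s, hs⟩ := Filter.nonempty_of_mem (inter_mem (nhdsWithin_mono y hsub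
    (hψ.image_mem_nhdsWithin y hyL)) self_mem_nhdsWithin)
  refine ⟨-t + s, ?_⟩
  simp only at hs ⊢
  rw [ψ.map_add, hs, ← ψ.map_add, neg_add_cancel, ψ.map_zero_apply]

theorem isClosed_diff_range (x : E) :
    IsClosed (ballLevel f r ε \ range fun t => ψ t x) := by
  refine isClosed_of_closure_subset fun y hy => ?_
  have hyL := closure_minimal sdiff_subset hf.isCompact_ballLevel.isClosed hy
  refine ⟨hyL, ?_⟩
  rintro ⟨s, rfl⟩
  have := mem_closure_iff_nhdsWithin_neBot.1 hy
  obtain ⟨_, ⟨t, -, rfl⟩, -, hn⟩ := Filter.nonempty_of_mem (inter_mem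
    (nhdsWithin_mono _ (sdiff_subset (t := range fun t => ψ t x))
      (hψ.image_mem_nhdsWithin _ hyL)) self_mem_nhdsWithin)
  exact hn ⟨t + s, ψ.map_add _ _ _⟩

/-- Spheres around the origin are connected and meet every trajectory of the descent flow, so the
level set is a single orbit. -/
theorem range_eq [NormedSpace ℝ E] (hrank : 1 < Module.rank ℝ E) (hφ : IsDescentFlow f r φ d)
    {x : E} (hx : x ∈ ballLevel f r ε) : range (fun t => ψ t x) = ballLevel f r ε := by
  refine (hψ.range_subset hf hx).antisymm fun y hy => ?_
  by_contra hyx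
  obtain ⟨ρ, hρ, hρf⟩ : ∃ ρ > 0, ∀ p : E, ‖p‖ ≤ ρ → ‖p‖ ≤ r ∧ f p < ε := by
    have h := (hf.cont.continuousAt.eventually_lt continuousAt_const
      (hf.map_zero ▸ hf.height_pos)).and (closedBall_mem_nhds (0 : E) hf.radius_pos)
    obtain ⟨ρ, hρ, h⟩ := nhds_basis_closedBall.mem_iff.1 h
    refine ⟨ρ, hρ, fun p hp => ?_⟩
    have := h (mem_closedBall_zero_iff.2 hp)
    exact ⟨mem_closedBall_zero_iff.1 this.2, this.1⟩
  obtain ⟨T, hT, hTρ⟩ := hφ.exists_forall_norm_lt hf hρ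
  have hclosed {A : Set E} (hA : IsClosed A) (hAL : A ⊆ ballLevel f r ε) :
      IsClosed ((fun p : ℝ × E => φ p.1 p.2) '' Icc 0 T ×ˢ A) :=
    ((isCompact_Icc.prod (hf.isCompact_ballLevel.of_isClosed_subset hA hAL)).image
      (by fun_prop)).isClosed
  have hmeet {A : Set E} {a : E} (ha : a ∈ A) (haL : a ∈ ballLevel f r ε) :
      (sphere 0 ρ ∩ (fun p : ℝ × E => φ p.1 p.2) '' Icc 0 T ×ˢ A).Nonempty := by
    have haρ : ρ ≤ ‖a‖ := by
      by_contra! h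
      exact (hρf a h.le).2.ne haL.2
    obtain ⟨t, ht, htρ⟩ := isPreconnected_Icc.intermediate_value (f := fun t => ‖φ t a‖)
      (right_mem_Icc.2 hT) (left_mem_Icc.2 hT) (by fun_prop)
      ⟨(hTρ T le_rfl a (ballLevel_subset_ballSublevel haL)).le, by simpa using haρ⟩
    exact ⟨φ t a, mem_sphere_zero_iff_norm.2 htρ, (t, a), ⟨ht, ha⟩, rfl⟩
  obtain ⟨_, -, ⟨⟨s, a⟩, ⟨-, ha⟩, rfl⟩, ⟨t, b⟩, ⟨-, hb⟩, hab⟩ :=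
    isPreconnected_closed_iff.1 (isPreconnected_sphere hrank 0 ρ) _ _
      (hclosed (hψ.isClosed_range hf hx) (hψ.range_subset hf hx))
      (hclosed (hψ.isClosed_diff_range hf x) sdiff_subset)
      (fun p hp => by
        have hpρ := mem_sphere_zero_iff_norm.1 hp
        obtain ⟨hpr, hpε⟩ := hρf p hpρ.le
        obtain ⟨t, ht, z, hz, rfl⟩ := hφ.exists_map_eq hf ⟨hpr, hpε.le⟩
          (norm_pos_iff.1 (hpρ ▸ hρ))
        have htT : t ≤ T := by
          by_contra! h
          exact (hTρ t h.le z (ballLevel_subset_ballSublevel hz)).ne hpρ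
        by_cases hzx : z ∈ range fun t => ψ t x
        · exact Or.inl ⟨(t, z), ⟨⟨ht, htT⟩, hzx⟩, rfl⟩
        · exact Or.inr ⟨(t, z), ⟨⟨ht, htT⟩, hz, hzx⟩, rfl⟩)
      (hmeet ⟨0, rfl⟩ (hψ.map_mem hf hx 0)) (hmeet ⟨hy, hyx⟩ hy)
  have := (hφ.eq_of_map_eq hf hb.1 (hψ.range_subset hf hx ha) hab).2
  exact hb.2 (this ▸ ha)

/-- A compact orbit that is a neighbourhood of each of its points is periodic. -/
theorem exists_period {x : E} (hx : x ∈ ballLevel f r ε)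
    (hrange : range (fun t => ψ t x) = ballLevel f r ε) :
    ∃ T ≠ 0, ∀ s t, ψ s x = ψ t x ↔ ∃ n : ℤ, s - t = n * T := by
  let P : AddSubgroup ℝ :=
    { carrier := {t | ψ t x = x}
      zero_mem' := by simp
      add_mem' := fun {s t} (hs : ψ s x = x) (ht : ψ t x = x) => by
        simp only [mem_ofPred_eq, ψ.map_add, ht, hs]
      neg_mem' := fun {t} (ht : ψ t x = x) => by
        change ψ (-t) x = x
        conv_lhs => rw [← ht]
        rw [← ψ.map_add, neg_add_cancel, ψ.map_zero_apply] }
  have hP (s t : ℝ) : ψ s x = ψ t x ↔ s - t ∈ P := by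
    constructor
    · intro h
      change ψ (s - t) x = x
      rw [sub_eq_neg_add, ψ.map_add, h, ← ψ.map_add, neg_add_cancel, ψ.map_zero_apply]
    · intro h
      conv_rhs => rw [← show ψ (s - t) x = x from h]
      rw [← ψ.map_add, add_sub_cancel]
  obtain ⟨τ, hτP, hτ⟩ : ∃ τ ∈ P, τ ≠ 0 := by
    obtain ⟨F, hFL, hF⟩ := hf.isCompact_ballLevel.elim_nhdsWithin_subcover _
      hψ.image_mem_nhdsWithin
    rw [← hrange] at hFL
    choose! τ hτ using hFL
    obtain ⟨N, hN⟩ := (F.image τ).exists_le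
    obtain ⟨y, hy, u, hu, huy⟩ := mem_iUnion₂.1 (hF (hψ.map_mem hf hx (N + 1)))
    have hyN := hN _ (Finset.mem_image_of_mem τ hy)
    refine ⟨N + 1 - (u + τ y), (hP _ _).1 ?_, ?_⟩
    · rw [ψ.map_add u, ← huy]
      exact congrArg (ψ u) (hτ y hy).symm
    · linarith [hu.2]
  rcases P.dense_or_cyclic with hd | ⟨a, ha⟩
  · obtain ⟨t, ht⟩ := hψ.exists_map_ne x hx
    have hc : IsClosed (P : Set ℝ) :=
      isClosed_eq (f := fun t => ψ t x) (by fun_prop) continuous_const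
    exact (ht (hc.closure_eq.subset (hd t))).elim
  · simp only [ha, AddSubgroup.mem_closure_singleton, zsmul_eq_mul] at hP hτP
    refine ⟨a, ?_, fun s t => (hP s t).trans (exists_congr fun _ => eq_comm)⟩
    rintro rfl
    obtain ⟨n, hn⟩ := hτP
    exact hτ (by simpa using hn.symm)

theorem exists_loop [NormedSpace ℝ E] (hrank : 1 < Module.rank ℝ E)
    (hφ : IsDescentFlow f r φ d) {x : E} (hx : x ∈ ballLevel f r ε) :
    ∃ γ : ℝ → E, Continuous γ ∧ range γ = ballLevel f r ε ∧
      ∀ s t, γ s = γ t ↔ (s : Real.Angle) = t := by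
  have hrange := hψ.range_eq hf hrank hφ hx
  obtain ⟨T, hT, hper⟩ := hψ.exists_period hf hx hrange
  have hpi := Real.pi_ne_zero
  refine ⟨fun s => ψ (s * (T / (2 * Real.pi))) x, by fun_prop, ?_, fun s t => ?_⟩
  · rw [← hrange]
    refine Function.Surjective.range_comp (f := fun s : ℝ => s * (T / (2 * Real.pi)))
      (fun u => ⟨u * (2 * Real.pi / T), ?_⟩) fun t => ψ t x
    field_simp
  · rw [hper, Real.Angle.angle_eq_iff_two_pi_dvd_sub]
    refine exists_congr fun n => ?_
    field_simp

end IsLevelFlow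

end Level

section Disk

variable {E : Type*} [NormedAddCommGroup E] {f d : E → ℝ} {r ε : ℝ} {φ : Flow ℝ E}

theorem continuous_comp_toReal {X : Type*} [TopologicalSpace X] {γ : ℝ → X} (hγ : Continuous γ)
    (h : ∀ s t : ℝ, (s : Real.Angle) = t → γ s = γ t) :
    Continuous fun θ : Real.Angle => γ θ.toReal := by
  have hq : IsQuotientMap ((↑) : ℝ → Real.Angle) :=
    QuotientAddGroup.isQuotientMap_mk (AddSubgroup.zmultiples (2 * Real.pi))
  refine hq.continuous_iff.2 (hγ.congr fun s => ?_)
  exact h _ _ (Real.Angle.coe_toReal s).symm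

open Classical in
/-- Polar coordinates on a well: the angle parametrises the boundary loop `γ`, and the logarithm of
the radius is minus the time spent descending from it. -/
noncomputable def polarMap (φ : Flow ℝ E) (γ : ℝ → E) (z : ℂ) : E :=
  if z = 0 then 0 else φ (-Real.log ‖z‖) (γ z.arg)

variable {γ : ℝ → E}

theorem polarMap_zero : polarMap φ γ 0 = 0 := if_pos rfl

theorem polarMap_of_ne_zero {z : ℂ} (hz : z ≠ 0) :
    polarMap φ γ z = φ (-Real.log ‖z‖) (γ z.arg) := if_neg hz

theorem neg_log_norm_nonneg {z : ℂ} (hz : z ∈ closedBall (0 : ℂ) 1) : 0 ≤ -Real.log ‖z‖ :=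
  neg_nonneg.2 (Real.log_nonpos (norm_nonneg z) (mem_closedBall_zero_iff.1 hz))

namespace IsDescentFlow

variable (hφ : IsDescentFlow f r φ d) (hf : IsWell f r ε) (hγ : Continuous γ)
  (hrange : range γ = ballLevel f r ε) (hinj : ∀ s t, γ s = γ t ↔ (s : Real.Angle) = t)
include hφ hf hrange

theorem mapsTo_polarMap :
    MapsTo (polarMap φ γ) (closedBall 0 1) (ballSublevel f r ε) := by
  intro z hz
  by_cases h0 : z = 0
  · rw [h0, polarMap_zero]
    exact hf.zero_mem
  · rw [polarMap_of_ne_zero h0]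
    exact hφ.map_mem hf (ballLevel_subset_ballSublevel (hrange ▸ mem_range_self _))
      (neg_log_norm_nonneg hz)

include hinj

theorem injOn_polarMap : InjOn (polarMap φ γ) (closedBall 0 1) := by
  have hL (s : ℝ) : γ s ∈ ballLevel f r ε := hrange ▸ mem_range_self _
  have hne (t s : ℝ) : φ t (γ s) ≠ 0 := hφ.ne_zero (hf.ne_zero_of_mem_ballLevel (hL s)) t
  intro z hz w hw h
  by_cases hz0 : z = 0 <;> by_cases hw0 : w = 0
  · rw [hz0, hw0]
  · rw [hz0, polarMap_zero, polarMap_of_ne_zero hw0] at h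
    exact (hne _ _ h.symm).elim
  · rw [hw0, polarMap_zero, polarMap_of_ne_zero hz0] at h
    exact (hne _ _ h).elim
  · rw [polarMap_of_ne_zero hz0, polarMap_of_ne_zero hw0] at h
    obtain ⟨hlog, harg⟩ := hφ.eq_of_map_eq hf (hL _) (hL _) h
    exact Complex.ext_norm_arg
      (Real.log_injOn_pos (norm_pos_iff.2 hz0) (norm_pos_iff.2 hw0) (neg_inj.1 hlog))
      (Complex.arg_coe_angle_eq_iff.1 ((hinj _ _).1 harg))

variable [ProperSpace E]

theorem surjOn_polarMap : SurjOn (polarMap φ γ) (closedBall 0 1) (ballSublevel f r ε) := by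
  intro p hp
  by_cases h0 : p = 0
  · exact ⟨0, by simp, by rw [polarMap_zero, h0]⟩
  obtain ⟨t, ht, x, hx, rfl⟩ := hφ.exists_map_eq hf hp h0
  obtain ⟨s, rfl⟩ : x ∈ range γ := hrange ▸ hx
  set z : ℂ := (Real.exp (-t) : ℝ) * ((Real.Angle.cos s : ℝ) + (Real.Angle.sin s : ℝ) * Complex.I)
    with hz
  have hnorm : ‖z‖ = Real.exp (-t) := by
    rw [hz, norm_mul, Real.Angle.cos_coe, Real.Angle.sin_coe, Complex.ofReal_cos,
      Complex.ofReal_sin, Complex.norm_cos_add_sin_mul_I, mul_one, Complex.norm_real,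
      Real.norm_of_nonneg (Real.exp_pos _).le]
  have harg : (z.arg : Real.Angle) = s :=
    Complex.arg_mul_cos_add_sin_mul_I_coe_angle (Real.exp_pos _) s
  have hz0 : z ≠ 0 := norm_pos_iff.1 (hnorm ▸ Real.exp_pos _)
  refine ⟨z, ?_, ?_⟩
  · rw [mem_closedBall_zero_iff, hnorm]
    exact Real.exp_le_one_iff.2 (neg_nonpos.2 ht)
  · rw [polarMap_of_ne_zero hz0, hnorm, Real.log_exp, neg_neg, (hinj _ _).2 harg]

include hγ

theorem continuousOn_polarMap : ContinuousOn (polarMap φ γ) (closedBall 0 1) := by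
  intro z hz
  by_cases h0 : z = 0
  · subst h0
    rw [ContinuousWithinAt, polarMap_zero, Metric.tendsto_nhds]
    intro ρ hρ
    obtain ⟨T, hT, hTρ⟩ := hφ.exists_forall_norm_lt hf hρ
    filter_upwards [self_mem_nhdsWithin,
      mem_nhdsWithin_of_mem_nhds (ball_mem_nhds (0 : ℂ) (Real.exp_pos (-T)))] with w hw hwT
    rw [dist_zero_right]
    by_cases hw0 : w = 0
    · simpa [hw0, polarMap_zero] using hρ
    · rw [polarMap_of_ne_zero hw0]
      refine hTρ _ ?_ _ (ballLevel_subset_ballSublevel (hrange ▸ mem_range_self _))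
      have := (Real.log_lt_iff_lt_exp (norm_pos_iff.2 hw0)).2 (mem_ball_zero_iff.1 hwT)
      exact le_neg_of_le_neg this.le
  · refine ContinuousAt.continuousWithinAt ?_
    have h1 : ContinuousAt (fun w : ℂ => γ (w.arg : Real.Angle).toReal) z :=
      (continuous_comp_toReal hγ fun s t => (hinj s t).2).continuousAt.comp
        (f := fun w : ℂ => (w.arg : Real.Angle)) (Complex.continuousAt_arg_coe_angle h0)
    have h2 : ContinuousAt (fun w : ℂ => -Real.log ‖w‖) z :=
      (continuous_norm.continuousAt.log (norm_ne_zero_iff.2 h0)).neg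
    refine (φ.cont'.continuousAt.comp (h2.prodMk h1)).congr ?_
    filter_upwards [isOpen_ne.mem_nhds h0] with w hw
    simp [polarMap_of_ne_zero hw, Function.uncurry]

theorem nonempty_homeomorph :
    Nonempty (closedBall (0 : ℂ) 1 ≃ₜ ballSublevel f r ε) := by
  have hbij : BijOn (polarMap φ γ) (closedBall 0 1) (ballSublevel f r ε) :=
    ⟨hφ.mapsTo_polarMap hf hrange, hφ.injOn_polarMap hf hrange hinj,
      hφ.surjOn_polarMap hf hrange hinj⟩
  have : CompactSpace (closedBall (0 : ℂ) 1) :=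
    isCompact_iff_compactSpace.1 (isCompact_closedBall 0 1)
  exact ⟨Continuous.homeoOfEquivCompactToT2 (f := hbij.equiv)
    ((hφ.continuousOn_polarMap hf hγ hrange hinj).mapsToRestrict hbij.mapsTo)⟩

end IsDescentFlow

end Disk

section Gradient

open scoped Gradient ContDiff RealInnerProductSpace

variable {E : Type*} [NormedAddCommGroup E] [InnerProductSpace ℝ E]

theorem ContDiff.gradient [CompleteSpace E] {f : E → ℝ} (hf : ContDiff ℝ 2 f) :
    ContDiff ℝ 1 (∇ f) :=
  (InnerProductSpace.toDual ℝ E).symm.contDiff.comp (hf.fderiv_right le_rfl)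

theorem gradient_ne_zero_iff [CompleteSpace E] {f : E → ℝ} {p : E} :
    ∇ f p ≠ 0 ↔ fderiv ℝ f p ≠ 0 := by
  rw [← toDual_gradient, Ne, Ne, LinearIsometryEquiv.map_eq_zero_iff]

variable {f : E → ℝ} {r ε : ℝ}

/-- Cutting off the negative gradient field outside a ball gives a descent flow. -/
theorem IsWell.exists_isDescentFlow [FiniteDimensional ℝ E] (hf : IsWell f r ε)
    (hc : ContDiff ℝ 2 f) (hreg : ∀ p, ‖p‖ ≤ r → p ≠ 0 → fderiv ℝ f p ≠ 0) :
    ∃ φ d, IsDescentFlow f r φ d := by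
  have : CompleteSpace E := FiniteDimensional.complete ℝ E
  let χ : ContDiffBump (0 : E) := ⟨r, r + 1, hf.radius_pos, lt_add_one r⟩
  have hg := hc.gradient
  have hv : ContDiff ℝ 1 ((χ : E → ℝ) • fun p => -∇ f p) := χ.contDiff.smul hg.neg
  obtain ⟨φ, hφ, hφ0⟩ := exists_flow_of_contDiff hv χ.hasCompactSupport.smul_right
  have hg0 : ∇ f 0 = 0 := by
    have : IsLocalMin f 0 := by
      filter_upwards [ball_mem_nhds (0 : E) hf.radius_pos] with p hp
      rw [hf.map_zero]
      by_cases h0 : p = 0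
      · rw [h0, hf.map_zero]
      · exact (hf.pos p (mem_ball_zero_iff.1 hp).le h0).le
    by_contra h
    exact gradient_ne_zero_iff.1 h this.fderiv_eq_zero
  refine ⟨φ, fun p => χ p * ‖∇ f p‖ ^ 2, ?_, fun p => ?_, fun p hp h0 => ?_, fun p t => ?_,
    hφ0 0 ?_⟩
  · exact χ.continuous.mul (hg.continuous.norm.pow 2)
  · exact mul_nonneg χ.nonneg (sq_nonneg _)
  · rw [χ.one_of_mem_closedBall (mem_closedBall_zero_iff.2 hp), one_mul]
    exact pow_pos (norm_pos_iff.2 (gradient_ne_zero_iff.2 (hreg p hp h0))) 2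
  · have h := ((hc.differentiable two_ne_zero) (φ t p)).hasFDerivAt.comp_hasDerivAt t (hφ p t)
    refine h.congr_deriv ?_
    rw [← inner_gradient_left]
    simp [inner_smul_right]
  · simp [hg0]

end Gradient

section Plane

open scoped Gradient ContDiff RealInnerProductSpace

variable {f : ℂ → ℝ} {r ε : ℝ}

theorem inner_I_mul_self (z : ℂ) : ⟪z, Complex.I * z⟫ = 0 := by
  simp [Complex.inner]
  ring

theorem range_smul_I_mul_add_smul {g : ℂ} (hg : g ≠ 0) :
    ((ContinuousLinearMap.fst ℝ ℝ ℝ).smulRight (Complex.I * g) +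
      (ContinuousLinearMap.snd ℝ ℝ ℝ).smulRight g).range = ⊤ := by
  refine LinearMap.range_eq_top.2 fun z => ⟨((z / g).im, (z / g).re), ?_⟩
  calc ((z / g).im : ℝ) • (Complex.I * g) + ((z / g).re : ℝ) • g
      = ((z / g).re + (z / g).im * Complex.I) * g := by
        simp only [Complex.real_smul]
        ring
    _ = z := by rw [Complex.re_add_im, div_mul_cancel₀ _ hg]

/-- A curve in a level set that moves orthogonally to the gradient covers a neighbourhood of its
starting point in the level set. -/
theorem image_Ioo_mem_nhdsWithin_level (hc : ContDiff ℝ 1 f) {x : ℂ} (hx : ∇ f x ≠ 0)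
    {c : ℝ → ℂ} (hc0 : c 0 = x) (hcf : ∀ t, f (c t) = f x)
    (hd : HasStrictDerivAt c (Complex.I * ∇ f x) 0) :
    c '' Ioo (-1) 1 ∈ 𝓝[{p | f p = f x}] x := by
  set g := ∇ f x with hg
  let F : ℝ × ℝ → ℂ := fun p => c p.1 + p.2 • g
  have hF0 : F 0 = x := by simp [F, hc0]
  have hF : HasStrictFDerivAt F ((ContinuousLinearMap.fst ℝ ℝ ℝ).smulRight (Complex.I * g) +
      (ContinuousLinearMap.snd ℝ ℝ ℝ).smulRight g) 0 := by
    refine HasStrictFDerivAt.add ?_ ?_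
    · have hd1 : HasStrictDerivAt c (Complex.I * g) (0 : ℝ × ℝ).1 := hd
      refine (hd1.hasStrictFDerivAt.comp (0 : ℝ × ℝ) hasStrictFDerivAt_fst).congr_fderiv ?_
      ext <;> simp
    · exact hasStrictFDerivAt_snd.smul_const g
  have hmap := hF.map_nhds_eq_of_surj (range_smul_I_mul_add_smul hx)
  have hFc : ContinuousAt F 0 := hF.continuousAt
  have hpos : ∀ᶠ p in 𝓝 (0 : ℝ × ℝ), 0 < fderiv ℝ f (F p) g := by
    have h1 : ContinuousAt (fun p => fderiv ℝ f (F p) g) 0 :=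
      ((hc.continuous_fderiv one_ne_zero).continuousAt.comp hFc).clm_apply continuousAt_const
    refine continuousAt_const.eventually_lt h1 ?_
    rw [hF0, ← inner_gradient_left, ← hg, real_inner_self_eq_norm_sq]
    exact pow_pos (norm_pos_iff.2 hx) 2
  obtain ⟨δ, hδ, hball⟩ := Metric.eventually_nhds_iff_ball.1 hpos
  have hU : ball (0 : ℝ × ℝ) (min δ 1) ∈ 𝓝 0 := ball_mem_nhds _ (lt_min hδ one_pos)
  have himg : F '' ball 0 (min δ 1) ∈ 𝓝 x := by
    rw [← hF0, ← hmap]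
    exact image_mem_map hU
  filter_upwards [mem_nhdsWithin_of_mem_nhds himg, self_mem_nhdsWithin]
  rintro _ ⟨⟨t, s⟩, hts, rfl⟩ hlev
  simp only [mem_ball_zero_iff, Prod.norm_mk, lt_min_iff, max_lt_iff, Real.norm_eq_abs] at hts
  obtain ⟨⟨htδ, hsδ⟩, ht1, -⟩ := hts
  refine ⟨t, abs_lt.1 ht1, ?_⟩
  have hderiv (u : ℝ) : HasDerivAt (fun u => f (F (t, u))) (fderiv ℝ f (F (t, u)) g) u := by
    refine ((hc.differentiable one_ne_zero) _).hasFDerivAt.comp_hasDerivAt u ?_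
    simpa [F] using ((hasDerivAt_id u).smul_const g).const_add (c t)
  have hmono : StrictMonoOn (fun u => f (F (t, u))) (Ioo (-δ) δ) := by
    refine strictMonoOn_of_deriv_pos (convex_Ioo _ _)
      (HasDerivAt.continuousOn fun u _ => hderiv u) fun u hu => ?_
    rw [(hderiv u).deriv]
    refine hball _ ?_
    have huδ : u ∈ Ioo (-δ) δ := interior_subset hu
    simpa using ⟨htδ, abs_lt.2 huδ⟩
  have hs : s = 0 := by
    refine hmono.injOn (abs_lt.1 hsδ) ⟨by linarith, hδ⟩ ?_
    simpa [F, hcf] using hlev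
  simp [F, hs]

/-- Rotating the gradient field by a right angle and cutting it off outside a ball gives a level
flow. -/
theorem IsWell.exists_isLevelFlow (hf : IsWell f r ε) (hc : ContDiff ℝ 2 f)
    (hreg : ∀ p, ‖p‖ ≤ r → p ≠ 0 → fderiv ℝ f p ≠ 0) : ∃ ψ, IsLevelFlow f r ε ψ := by
  let χ : ContDiffBump (0 : ℂ) := ⟨r, r + 1, hf.radius_pos, lt_add_one r⟩
  have hg := hc.gradient
  have hv : ContDiff ℝ 1 ((χ : ℂ → ℝ) • fun p => Complex.I * ∇ f p) :=
    χ.contDiff.smul (contDiff_const.mul hg)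
  obtain ⟨ψ, hψ, -⟩ := exists_flow_of_contDiff hv χ.hasCompactSupport.smul_right
  have hd (p : ℂ) (t : ℝ) : HasDerivAt (fun t => f (ψ t p)) 0 t := by
    have h := ((hc.differentiable two_ne_zero) (ψ t p)).hasFDerivAt.comp_hasDerivAt t (hψ p t)
    refine h.congr_deriv ?_
    rw [Pi.smul_apply', map_smul, ← inner_gradient_left, inner_I_mul_self, smul_zero]
  have hconst (t : ℝ) (p : ℂ) : f (ψ t p) = f p := by
    simpa using is_const_of_deriv_eq_zero (fun t => (hd p t).differentiableAt)
      (fun t => (hd p t).deriv) t 0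
  have hgne {x : ℂ} (hx : x ∈ ballLevel f r ε) : ∇ f x ≠ 0 :=
    gradient_ne_zero_iff.2 (hreg x hx.1 (hf.ne_zero_of_mem_ballLevel hx))
  have hχ {x : ℂ} (hx : x ∈ ballLevel f r ε) :
      ((χ : ℂ → ℝ) • fun p => Complex.I * ∇ f p) x = Complex.I * ∇ f x := by
    simp [χ.one_of_mem_closedBall (mem_closedBall_zero_iff.2 hx.1)]
  refine ⟨ψ, hconst, fun x hx => ?_, fun x hx => ?_⟩
  · have hsub : ballLevel f r ε ⊆ {p | f p = f x} := fun p hp => hp.2.trans hx.2.symm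
    refine nhdsWithin_mono x hsub (image_Ioo_mem_nhdsWithin_level (hc.of_le one_le_two)
      (hgne hx) (ψ.map_zero_apply x) (fun t => hconst t x) ?_)
    have h := hasStrictDerivAt_of_hasDerivAt_of_continuousAt (x := (0 : ℝ))
      (Eventually.of_forall (hψ x)) (hv.continuous.comp
        (by fun_prop : Continuous fun t : ℝ => ψ t x)).continuousAt
    rwa [ψ.map_zero_apply, hχ hx] at h
  · by_contra! h
    have h0 := hψ x 0
    rw [ψ.map_zero_apply, hχ hx, funext h] at h0
    exact mul_ne_zero Complex.I_ne_zero (hgne hx) (h0.unique (hasDerivAt_const 0 x))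

theorem IsWell.nonempty_homeomorph_and_connectedComponentIn_eq (hf : IsWell f r ε)
    (hc : ContDiff ℝ 2 f) (hreg : ∀ p, ‖p‖ ≤ r → p ≠ 0 → fderiv ℝ f p ≠ 0) :
    Nonempty (closedBall (0 : ℂ) 1 ≃ₜ ballSublevel f r ε) ∧
      connectedComponentIn {p | f p ≤ ε} 0 = ballSublevel f r ε := by
  obtain ⟨φ, d, hφ⟩ := hf.exists_isDescentFlow hc hreg
  obtain ⟨ψ, hψ⟩ := hf.exists_isLevelFlow hc hreg
  obtain ⟨p, hp, h0⟩ := Filter.nonempty_of_mem (inter_mem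
    (mem_nhdsWithin_of_mem_nhds hf.ballSublevel_mem_nhds_zero)
    (self_mem_nhdsWithin : {(0 : ℂ)}ᶜ ∈ 𝓝[≠] 0))
  obtain ⟨-, -, x, hx, -⟩ := hφ.exists_map_eq hf hp h0
  have hrank : 1 < Module.rank ℝ ℂ := by
    rw [Complex.rank_real_complex]
    exact Cardinal.one_lt_two
  obtain ⟨γ, hγ, hrange, hinj⟩ := hψ.exists_loop hf hrank hφ hx
  exact ⟨hφ.nonempty_homeomorph hf hγ hrange hinj, hφ.connectedComponentIn_eq hf⟩

end Plane

theorem MvPolynomial.contDiff_eval {𝕜 E σ : Type*} [NontriviallyNormedField 𝕜]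
    [NormedAddCommGroup E] [NormedSpace 𝕜 E] {n : WithTop ℕ∞} {c : E → σ → 𝕜}
    (hc : ∀ i, ContDiff 𝕜 n fun q => c q i) (F : MvPolynomial σ 𝕜) :
    ContDiff 𝕜 n fun q => MvPolynomial.eval (c q) F := by
  induction F using MvPolynomial.induction_on with
  | C a => simpa using contDiff_const
  | add p q hp hq => simpa using hp.add hq
  | mul_X p i hp => simpa using hp.mul (hc i)

/-- Let `f : ℝ² → ℝ` be a polynomial function with `f(0,0) = 0`, and let `r > 0`
be such that `f > 0` and `∇f ≠ 0` on the punctured closed ball of radius `r` around the origin.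
Then for all sufficiently small `ε > 0`, the connected component `D_ε` containing the origin of
the sublevel set `{p : f p ≤ ε}` is homeomorphic to the closed unit disk `{v : ‖v‖ ≤ 1}`, and
the origin lies in the topological interior of `D_ε`. -/
theorem small_sublevel_component_homeomorphic_disk (f : EuclideanSpace ℝ (Fin 2) → ℝ)
    (hpoly : ∃ F : MvPolynomial (Fin 2) ℝ,
      ∀ q : EuclideanSpace ℝ (Fin 2), f q = MvPolynomial.eval ![q 0, q 1] F)
    (hf0 : f 0 = 0) (r : ℝ) (hr : 0 < r)
    (hpos : ∀ q ∈ Metric.closedBall (0 : EuclideanSpace ℝ (Fin 2)) r, q ≠ 0 → 0 < f q)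
    (hreg : ∀ q ∈ Metric.closedBall (0 : EuclideanSpace ℝ (Fin 2)) r, q ≠ 0 →
      fderiv ℝ f q ≠ 0) :
    ∃ ε₀ > 0, ∀ ε : ℝ, 0 < ε → ε < ε₀ →
      Nonempty (↥(connectedComponentIn {p : EuclideanSpace ℝ (Fin 2) | f p ≤ ε} 0) ≃ₜ
        ↥{v : EuclideanSpace ℝ (Fin 2) | ‖v‖ ≤ 1}) ∧
      (0 : EuclideanSpace ℝ (Fin 2)) ∈
        interior (connectedComponentIn {p : EuclideanSpace ℝ (Fin 2) | f p ≤ ε} 0) := by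
  obtain ⟨F, hF⟩ := hpoly
  have hfc : ContDiff ℝ 2 f := by
    rw [funext hF]
    refine F.contDiff_eval fun i => ?_
    fin_cases i
    · exact (EuclideanSpace.proj (𝕜 := ℝ) (0 : Fin 2)).contDiff
    · exact (EuclideanSpace.proj (𝕜 := ℝ) (1 : Fin 2)).contDiff
  let e := Complex.orthonormalBasisOneI.repr
  have hgc : ContDiff ℝ 2 (f ∘ e) := hfc.comp e.contDiff
  have hne {p : ℂ} (h : p ≠ 0) : e p ≠ 0 := e.map_eq_zero_iff.not.2 h
  have hgreg (p : ℂ) (hp : ‖p‖ ≤ r) (h0 : p ≠ 0) : fderiv ℝ (f ∘ e) p ≠ 0 := fun h =>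
    hreg (e p) (by simpa using hp) (hne h0) <| by
      have h1 := e.toContinuousLinearEquiv.comp_right_fderiv (f := f) (x := p)
      ext v
      obtain ⟨w, rfl⟩ := e.surjective v
      simpa [h] using (DFunLike.congr_fun h1 w).symm
  obtain ⟨q, hq, hmin⟩ := (isCompact_sphere (0 : ℂ) r).exists_isMinOn
    ((NormedSpace.sphere_nonempty).2 hr.le) hgc.continuous.continuousOn
  have hgpos (p : ℂ) (hp : ‖p‖ ≤ r) (h0 : p ≠ 0) : 0 < (f ∘ e) p :=
    hpos (e p) (by simpa using hp) (hne h0)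
  refine ⟨(f ∘ e) q, hgpos q (mem_sphere_zero_iff_norm.1 hq).le
    (ne_zero_of_mem_sphere hr.ne' ⟨q, hq⟩), fun ε hε hεq => ?_⟩
  have hwell : IsWell (f ∘ e) r ε := by
    refine ⟨hgc.continuous, hr, hε, by simp [hf0], hgpos, fun p hp => ?_⟩
    exact hεq.trans_le (hmin (mem_sphere_zero_iff_norm.2 hp))
  obtain ⟨⟨Φ⟩, hcomp⟩ := hwell.nonempty_homeomorph_and_connectedComponentIn_eq hgc hgreg
  have himg : connectedComponentIn {p | f p ≤ ε} 0 = e '' ballSublevel (f ∘ e) r ε := by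
    have h := e.toHomeomorph.image_connectedComponentIn
      (show (0 : ℂ) ∈ {p | (f ∘ e) p ≤ ε} by simpa [hf0] using hε.le)
    have hpre : e '' {p | (f ∘ e) p ≤ ε} = {p | f p ≤ ε} :=
      image_preimage_eq {p | f p ≤ ε} e.surjective
    rw [hcomp] at h
    simpa only [LinearIsometryEquiv.coe_toHomeomorph, hpre, map_zero] using h.symm
  have hdisk : e '' closedBall 0 1 = {v | ‖v‖ ≤ 1} := by
    ext v
    simp [e.image_closedBall]
  rw [himg]
  refine ⟨⟨((e.toHomeomorph.image _).symm.trans Φ.symm).trans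
    ((e.toHomeomorph.image _).trans (Homeomorph.setCongr hdisk))⟩, ?_⟩
  rw [mem_interior_iff_mem_nhds, ← map_zero e]
  exact e.toHomeomorph.isOpenMap.image_mem_nhds hwell.ballSublevel_mem_nhds_zero
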